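/- (Two-dimensional Korn–Poincaré estimate (4.19).) Assume additionally A_θ, A_z ∈ C²(closure of E), u ∈ C²(closure of E; ℝ³), u = 0 on ∂E; assume the uniform bounds 0 < a ≤ A_θ, A_z ≤ A, |∇A_θ| + |∇A_z| ≤ B; assume the Codazzi–Gauss identity ∂_z(A_{θ,z}/A_z) + ∂_θ(A_{z,θ}/A_θ) = −A_z A_θ κ_z κ_θ holds; assume κ_θ, κ_z ≥ 0 with (1/c)√(κ_θκ_z) ≤ κ_θ, κ_z ≤ c√(κ_θκ_z) on E; and assume there is ρ ∈ C¹ with κ_z = ρκ_θ, 0 < ρ₀ ≤ ρ ≤ ρ₁, |∇ρ| ≤ c₂. Let L = sup_θ (z₂(θ) − z₁(θ)). Then there exist constants C₀, C > 0, depending only on a, A, B, c, ρ₀, ρ₁, c₂, such that if L ≤ C₀ then ‖u_θ‖_{L²(E)} + ‖u_z‖_{L²(E)} ≤ C ‖|F^sym|‖_{L²(E)}. -/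

import Mathlib

open MeasureTheory Set Real

noncomputable section

/-- Partial derivative in `θ` of a scalar function on the parameter plane `(θ, z)`. -/
def dTh (f : ℝ × ℝ → ℝ) (p : ℝ × ℝ) : ℝ := fderiv ℝ f p (1, 0)

/-- Partial derivative in `z` of a scalar function on the parameter plane `(θ, z)`. -/
def dZ (f : ℝ × ℝ → ℝ) (p : ℝ × ℝ) : ℝ := fderiv ℝ f p (0, 1)

/-- The two-dimensional data: the functions `z1, z2` determining the parameter domain `E`,
the metric coefficients `Ath = A_θ`, `Az = A_z`, the principal curvatures `kth = κ_θ`,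
`kz = κ_z`, and the components `ut = u_t`, `uth = u_θ`, `uz = u_z` of a displacement. -/
structure Setup2D where
  z1 : ℝ → ℝ
  z2 : ℝ → ℝ
  Ath : ℝ × ℝ → ℝ
  Az : ℝ × ℝ → ℝ
  kth : ℝ × ℝ → ℝ
  kz : ℝ × ℝ → ℝ
  ut : ℝ × ℝ → ℝ
  uth : ℝ × ℝ → ℝ
  uz : ℝ × ℝ → ℝ

namespace Setup2D

/-- The parameter domain `E = {(θ,z) : θ ∈ (0,1), z ∈ (z1 θ, z2 θ)}`. -/
def E (S : Setup2D) : Set (ℝ × ℝ) :=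
  {p | p.1 ∈ Ioo (0 : ℝ) 1 ∧ p.2 ∈ Ioo (S.z1 p.1) (S.z2 p.1)}

/-- The entry `F₂₂` of the simplified gradient. -/
def F22 (S : Setup2D) (p : ℝ × ℝ) : ℝ :=
  (S.Az p * dTh S.uth p + S.Az p * S.Ath p * S.kth p * S.ut p + dZ S.Ath p * S.uz p) /
    (S.Az p * S.Ath p)

/-- The entry `F₂₃` of the simplified gradient. -/
def F23 (S : Setup2D) (p : ℝ × ℝ) : ℝ :=
  (S.Ath p * dZ S.uth p - dTh S.Az p * S.uz p) / (S.Az p * S.Ath p)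

/-- The entry `F₃₂` of the simplified gradient. -/
def F32 (S : Setup2D) (p : ℝ × ℝ) : ℝ :=
  (S.Az p * dTh S.uz p - dZ S.Ath p * S.uth p) / (S.Az p * S.Ath p)

/-- The entry `F₃₃` of the simplified gradient. -/
def F33 (S : Setup2D) (p : ℝ × ℝ) : ℝ :=
  (S.Ath p * dZ S.uz p + S.Az p * S.Ath p * S.kz p * S.ut p + dTh S.Az p * S.uth p) /
    (S.Az p * S.Ath p)

/-- `F₂₃^sym = (F₂₃ + F₃₂)/2`. -/
def F23sym (S : Setup2D) (p : ℝ × ℝ) : ℝ := (S.F23 p + S.F32 p) / 2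

/-- `|F^sym|² = F₂₂² + 2 (F₂₃^sym)² + F₃₃²`. -/
def FsymSq (S : Setup2D) (p : ℝ × ℝ) : ℝ := S.F22 p ^ 2 + 2 * S.F23sym p ^ 2 + S.F33 p ^ 2

/-- The weighted inner product `(f, g)_E = ∫_E A_θ A_z f g dθ dz`. -/
def ip (S : Setup2D) (f g : ℝ × ℝ → ℝ) : ℝ := ∫ p in S.E, S.Ath p * S.Az p * f p * g p

/-- The weighted squared norm `‖f‖²_E`. -/
def nsq (S : Setup2D) (f : ℝ × ℝ → ℝ) : ℝ := S.ip f f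

/-- The weighted squared norm `‖|F^sym|‖²_E` of the simplified symmetrized gradient. -/
def nF (S : Setup2D) : ℝ := ∫ p in S.E, S.Ath p * S.Az p * S.FsymSq p

/-- The standing context: the form of the domain, the regularity `A_θ, A_z, κ_θ, κ_z ∈ C¹`,
positivity of `A_θ, A_z` on the closure of `E`, and `u ∈ C¹`. -/
def Base (S : Setup2D) : Prop :=
  (∀ θ ∈ Icc (0 : ℝ) 1, 0 ≤ S.z1 θ ∧ S.z1 θ < S.z2 θ ∧ S.z2 θ ≤ 1) ∧
  ContDiff ℝ 1 S.Ath ∧ ContDiff ℝ 1 S.Az ∧ ContDiff ℝ 1 S.kth ∧ ContDiff ℝ 1 S.kz ∧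
  (∀ p ∈ closure S.E, 0 < S.Ath p ∧ 0 < S.Az p) ∧
  ContDiff ℝ 1 S.ut ∧ ContDiff ℝ 1 S.uth ∧ ContDiff ℝ 1 S.uz

/-- The boundary condition `u = 0` on `∂E`. -/
def BZero (S : Setup2D) : Prop := ∀ p ∈ frontier S.E, S.ut p = 0 ∧ S.uth p = 0 ∧ S.uz p = 0

/-- The additional `C²` regularity of `A_θ, A_z` and `u`. -/
def Csq (S : Setup2D) : Prop :=
  ContDiff ℝ 2 S.Ath ∧ ContDiff ℝ 2 S.Az ∧
  ContDiff ℝ 2 S.ut ∧ ContDiff ℝ 2 S.uth ∧ ContDiff ℝ 2 S.uz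

/-- The Codazzi–Gauss identity `∂_z(A_{θ,z}/A_z) + ∂_θ(A_{z,θ}/A_θ) = -A_z A_θ κ_z κ_θ`. -/
def CodazziGauss (S : Setup2D) : Prop :=
  ∀ p ∈ S.E,
    dZ (fun q => dZ S.Ath q / S.Az q) p + dTh (fun q => dTh S.Az q / S.Ath q) p =
      -(S.Az p * S.Ath p * S.kz p * S.kth p)

/-- The uniform bounds `a ≤ A_θ, A_z ≤ A` and `|∇A_θ| + |∇A_z| ≤ B` on the closure of `E`. -/
def Bounds (S : Setup2D) (a A B : ℝ) : Prop :=
  ∀ p ∈ closure S.E, a ≤ S.Ath p ∧ S.Ath p ≤ A ∧ a ≤ S.Az p ∧ S.Az p ≤ A ∧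
    ‖fderiv ℝ S.Ath p‖ + ‖fderiv ℝ S.Az p‖ ≤ B

/-- `ρ` satisfies `κ_z = ρ κ_θ` with `ρ₀ ≤ ρ ≤ ρ₁` and `|∇ρ| ≤ c2`. -/
def RhoHyp (S : Setup2D) (ρ : ℝ × ℝ → ℝ) (ρ0 ρ1 c2 : ℝ) : Prop :=
  ContDiff ℝ 1 ρ ∧ (∀ p ∈ S.E, S.kz p = ρ p * S.kth p) ∧
  (∀ p ∈ closure S.E, ρ0 ≤ ρ p ∧ ρ p ≤ ρ1 ∧ ‖fderiv ℝ ρ p‖ ≤ c2)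

/-- Nonnegativity of the curvatures and the comparability condition
`(1/c)√(κ_θ κ_z) ≤ κ_θ, κ_z ≤ c √(κ_θ κ_z)` on `E`. -/
def Comparable (S : Setup2D) (c : ℝ) : Prop :=
  ∀ p ∈ S.E, 0 ≤ S.kth p ∧ 0 ≤ S.kz p ∧
    c⁻¹ * Real.sqrt (S.kth p * S.kz p) ≤ S.kth p ∧
    S.kth p ≤ c * Real.sqrt (S.kth p * S.kz p) ∧
    c⁻¹ * Real.sqrt (S.kth p * S.kz p) ≤ S.kz p ∧
    S.kz p ≤ c * Real.sqrt (S.kth p * S.kz p)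

end Setup2D

open Filter Topology

/-- A `C¹` function on the line vanishing on the boundary of a bounded open set has a derivative of
mean zero on that set. -/
theorem setIntegral_deriv_eq_zero_of_frontier {U : Set ℝ} (hU : IsOpen U)
    (hb : Bornology.IsBounded U) {g g' : ℝ → ℝ} (hg : ∀ x, HasDerivAt g (g' x) x)
    (hg' : Continuous g') (h0 : ∀ x ∈ frontier U, g x = 0) : ∫ x in U, g' x = 0 := by
  obtain ⟨R, hR, hUR⟩ := hb.subset_ball_lt 0 0
  rw [Real.ball_eq_Ioo, zero_sub, zero_add] at hUR
  have hgc : Continuous g := continuous_iff_continuousAt.2 fun x => (hg x).continuousAt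
  -- the zeros at which `g' ≠ 0` are isolated, hence countable
  have hcount := countable_setOfPred_isolated_right_within (s := {x | g x = 0})
  have key := MeasureTheory.integral_eq_of_hasDerivAt_off_countable_of_le
    (U.indicator g) (U.indicator g') (a := -R) (b := R) (by linarith) hcount
    (continuous_indicator h0 hgc.continuousOn).continuousOn ?_ ?_
  · rw [indicator_of_notMem (fun h => (hUR h).2.false),
      indicator_of_notMem (fun h => (hUR h).1.false), sub_zero,
      intervalIntegral.integral_of_le (by linarith), setIntegral_indicator hU.measurableSet,
      inter_eq_right.2 (hUR.trans Ioo_subset_Ioc_self)] at key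
    exact key
  · rintro x ⟨-, hx⟩
    by_cases hxU : x ∈ U
    · rw [indicator_of_mem hxU]
      refine (hg x).congr_of_eventuallyEq ?_
      filter_upwards [hU.mem_nhds hxU] with y hy using indicator_of_mem hy g
    rw [indicator_of_notMem hxU]
    by_cases hxc : x ∈ closure U
    · have hgx : g x = 0 := h0 x ⟨hxc, by rwa [hU.interior_eq]⟩
      have hg'x : g' x = 0 := by
        by_contra hne
        refine hx ⟨hgx, ?_⟩
        rw [← empty_mem_iff_bot, mem_nhdsWithin_iff_eventually]
        have := (hg x).eventually_ne (c := 0) hne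
        rw [eventually_nhdsWithin_iff] at this
        filter_upwards [this] with y hy hy'
        exact hy (ne_of_gt hy'.2) hy'.1
      have := (hg x)
      rw [hg'x, hasDerivAt_iff_isLittleO] at this
      rw [hasDerivAt_iff_isLittleO]
      refine Asymptotics.IsBigO.trans_isLittleO (Asymptotics.isBigO_of_le _ fun y => ?_) this
      rw [indicator_of_notMem hxU, hgx]
      simpa using norm_indicator_le_norm_self g y
    · refine (hasDerivAt_const x (0 : ℝ)).congr_of_eventuallyEq ?_
      filter_upwards [isClosed_closure.isOpen_compl.mem_nhds hxc] with y hy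
      exact indicator_of_notMem (fun h => hy (subset_closure h)) g
  · rw [intervalIntegrable_iff]
    exact ((hg'.intervalIntegrable _ _).1.indicator hU.measurableSet).mono_set
      (by rw [uIoc_of_le (by linarith)])

theorem integrableOn_of_isBounded {X : Type*} [MetricSpace X] [ProperSpace X]
    [MeasurableSpace X] [OpensMeasurableSpace X] {μ : Measure X} [IsFiniteMeasureOnCompacts μ]
    {U : Set X} (hb : Bornology.IsBounded U) {f : X → ℝ} (hf : Continuous f) :
    IntegrableOn f U μ :=
  (hf.continuousOn.integrableOn_compact hb.isCompact_closure).mono_set subset_closure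

/-- Poincaré inequality on an open subset of a short interval. -/
theorem setIntegral_sq_le_of_frontier {U : Set ℝ} (hU : IsOpen U)
    (hb : Bornology.IsBounded U) {g g' : ℝ → ℝ} (hg : ∀ x, HasDerivAt g (g' x) x)
    (hg' : Continuous g') (h0 : ∀ x ∈ frontier U, g x = 0) {x₀ L : ℝ}
    (hL : ∀ x ∈ U, |x - x₀| ≤ L) :
    ∫ x in U, g x ^ 2 ≤ 4 * L ^ 2 * ∫ x in U, g' x ^ 2 := by
  have hgc : Continuous g := continuous_iff_continuousAt.2 fun x => (hg x).continuousAt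
  have hz := setIntegral_deriv_eq_zero_of_frontier hU hb
    (g := fun x => (x - x₀) * g x ^ 2)
    (g' := fun x => g x ^ 2 + 2 * (x - x₀) * g x * g' x)
    (fun x => by
      have := (((hasDerivAt_id' x).sub_const x₀).fun_mul ((hg x).fun_pow 2))
      refine this.congr_deriv ?_
      push_cast
      ring)
    (by fun_prop) (fun x hx => by simp [h0 x hx])
  have i1 : IntegrableOn (fun x => g x ^ 2) U := integrableOn_of_isBounded hb (by fun_prop)
  have i2 : IntegrableOn (fun x => g' x ^ 2) U := integrableOn_of_isBounded hb (by fun_prop)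
  have i3 : IntegrableOn (fun x => g x ^ 2 + 2 * (x - x₀) * g x * g' x) U :=
    integrableOn_of_isBounded hb (by fun_prop)
  have hle : ∫ x in U, (1 / 2 * g x ^ 2 - 2 * L ^ 2 * g' x ^ 2)
      ≤ ∫ x in U, (g x ^ 2 + 2 * (x - x₀) * g x * g' x) := by
    refine setIntegral_mono_on ((i1.const_mul _).sub (i2.const_mul _)) i3 hU.measurableSet
      fun x hx => ?_
    have h1 : (x - x₀) ^ 2 ≤ L ^ 2 := sq_le_sq' (abs_le.1 (hL x hx)).1 (abs_le.1 (hL x hx)).2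
    nlinarith [sq_nonneg (g x + 2 * (x - x₀) * g' x),
      mul_le_mul_of_nonneg_right h1 (sq_nonneg (g' x))]
  rw [integral_sub (i1.const_mul _) (i2.const_mul _), integral_const_mul, integral_const_mul,
    hz] at hle
  linarith

section Slices

variable {Ω : Set (ℝ × ℝ)}

theorem setIntegral_eq_integral_slice_snd (hΩ : MeasurableSet Ω) {f : ℝ × ℝ → ℝ}
    (hf : IntegrableOn f Ω) :
    ∫ p in Ω, f p = ∫ x, ∫ y in Prod.mk x ⁻¹' Ω, f (x, y) := by
  rw [← integral_indicator hΩ, Measure.volume_eq_prod, integral_prod _ (hf.integrable_indicator hΩ)]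
  refine integral_congr_ae (.of_forall fun x => ?_)
  exact integral_indicator (f := fun y => f (x, y)) (measurable_prodMk_left hΩ)

theorem setIntegral_eq_integral_slice_fst (hΩ : MeasurableSet Ω) {f : ℝ × ℝ → ℝ}
    (hf : IntegrableOn f Ω) :
    ∫ p in Ω, f p = ∫ y, ∫ x in (fun x => (x, y)) ⁻¹' Ω, f (x, y) := by
  rw [← integral_indicator hΩ, Measure.volume_eq_prod,
    integral_prod_symm _ (hf.integrable_indicator hΩ)]
  refine integral_congr_ae (.of_forall fun y => ?_)
  exact integral_indicator (f := fun x => f (x, y)) (measurable_prodMk_right hΩ)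

theorem integrable_slice_snd (hΩ : MeasurableSet Ω) {f : ℝ × ℝ → ℝ} (hf : IntegrableOn f Ω) :
    Integrable fun x => ∫ y in Prod.mk x ⁻¹' Ω, f (x, y) := by
  have := (hf.integrable_indicator hΩ).integral_prod_left
  refine this.congr (.of_forall fun x => ?_)
  exact integral_indicator (f := fun y => f (x, y)) (measurable_prodMk_left hΩ)

theorem isBounded_slice_snd (hb : Bornology.IsBounded Ω) (x : ℝ) :
    Bornology.IsBounded (Prod.mk x ⁻¹' Ω) :=
  hb.image_snd.subset fun y hy => ⟨(x, y), hy, rfl⟩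

theorem isBounded_slice_fst (hb : Bornology.IsBounded Ω) (y : ℝ) :
    Bornology.IsBounded ((fun x => (x, y)) ⁻¹' Ω) :=
  hb.image_fst.subset fun x hx => ⟨(x, y), hx, rfl⟩

theorem hasDerivAt_slice_snd {f : ℝ × ℝ → ℝ} (hf : Differentiable ℝ f) (x y : ℝ) :
    HasDerivAt (fun y => f (x, y)) (dZ f (x, y)) y :=
  (hf (x, y)).hasFDerivAt.comp_hasDerivAt y ((hasDerivAt_const y x).prodMk (hasDerivAt_id y))

theorem hasDerivAt_slice_fst {f : ℝ × ℝ → ℝ} (hf : Differentiable ℝ f) (x y : ℝ) :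
    HasDerivAt (fun x => f (x, y)) (dTh f (x, y)) x :=
  (hf (x, y)).hasFDerivAt.comp_hasDerivAt x ((hasDerivAt_id x).prodMk (hasDerivAt_const x y))

theorem contDiff_dZ {f : ℝ × ℝ → ℝ} {m n : WithTop ℕ∞} (hf : ContDiff ℝ n f) (h : m + 1 ≤ n) :
    ContDiff ℝ m (dZ f) := (hf.fderiv_right h).clm_apply contDiff_const

theorem contDiff_dTh {f : ℝ × ℝ → ℝ} {m n : WithTop ℕ∞} (hf : ContDiff ℝ n f) (h : m + 1 ≤ n) :
    ContDiff ℝ m (dTh f) := (hf.fderiv_right h).clm_apply contDiff_const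

theorem continuous_dZ {f : ℝ × ℝ → ℝ} (hf : ContDiff ℝ 1 f) : Continuous (dZ f) :=
  (contDiff_dZ (m := 0) hf (by norm_num)).continuous

theorem continuous_dTh {f : ℝ × ℝ → ℝ} (hf : ContDiff ℝ 1 f) : Continuous (dTh f) :=
  (contDiff_dTh (m := 0) hf (by norm_num)).continuous

theorem setIntegral_dZ_eq_zero (hΩ : IsOpen Ω) (hb : Bornology.IsBounded Ω) {f : ℝ × ℝ → ℝ}
    (hf : ContDiff ℝ 1 f) (h0 : ∀ p ∈ frontier Ω, f p = 0) : ∫ p in Ω, dZ f p = 0 := by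
  have hc := continuous_dZ hf
  rw [setIntegral_eq_integral_slice_snd hΩ.measurableSet (integrableOn_of_isBounded hb hc)]
  refine integral_eq_zero_of_ae (.of_forall fun x => ?_)
  have hx : Continuous (Prod.mk x : ℝ → ℝ × ℝ) := by fun_prop
  exact setIntegral_deriv_eq_zero_of_frontier (hΩ.preimage hx) (isBounded_slice_snd hb x)
    (hasDerivAt_slice_snd (hf.differentiable one_ne_zero) x) (hc.comp hx)
    fun y hy => h0 _ (hx.frontier_preimage_subset _ hy)

theorem setIntegral_dTh_eq_zero (hΩ : IsOpen Ω) (hb : Bornology.IsBounded Ω) {f : ℝ × ℝ → ℝ}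
    (hf : ContDiff ℝ 1 f) (h0 : ∀ p ∈ frontier Ω, f p = 0) : ∫ p in Ω, dTh f p = 0 := by
  have hc := continuous_dTh hf
  rw [setIntegral_eq_integral_slice_fst hΩ.measurableSet (integrableOn_of_isBounded hb hc)]
  refine integral_eq_zero_of_ae (.of_forall fun y => ?_)
  have hy : Continuous (fun x : ℝ => (x, y)) := by fun_prop
  exact setIntegral_deriv_eq_zero_of_frontier (hΩ.preimage hy) (isBounded_slice_fst hb y)
    (fun x => hasDerivAt_slice_fst (hf.differentiable one_ne_zero) x y) (hc.comp hy)
    fun x hx => h0 _ (hy.frontier_preimage_subset _ hx)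

/-- Poincaré inequality on a plane domain which is thin in the second variable. -/
theorem setIntegral_sq_le_dZ (hΩ : IsOpen Ω) (hb : Bornology.IsBounded Ω) {f : ℝ × ℝ → ℝ}
    (hf : ContDiff ℝ 1 f) (h0 : ∀ p ∈ frontier Ω, f p = 0) {z₀ : ℝ → ℝ} {L : ℝ}
    (hL : ∀ p ∈ Ω, |p.2 - z₀ p.1| ≤ L) :
    ∫ p in Ω, f p ^ 2 ≤ 4 * L ^ 2 * ∫ p in Ω, dZ f p ^ 2 := by
  have hc := continuous_dZ hf
  have i1 : IntegrableOn (fun p => f p ^ 2) Ω :=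
    integrableOn_of_isBounded hb (hf.continuous.pow 2)
  have i2 : IntegrableOn (fun p => dZ f p ^ 2) Ω := integrableOn_of_isBounded hb (hc.pow 2)
  rw [setIntegral_eq_integral_slice_snd hΩ.measurableSet i1,
    setIntegral_eq_integral_slice_snd hΩ.measurableSet i2, ← integral_const_mul]
  refine integral_mono (integrable_slice_snd hΩ.measurableSet i1)
    ((integrable_slice_snd hΩ.measurableSet i2).const_mul _) fun x => ?_
  have hx : Continuous (Prod.mk x : ℝ → ℝ × ℝ) := by fun_prop
  exact setIntegral_sq_le_of_frontier (hΩ.preimage hx) (isBounded_slice_snd hb x)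
    (hasDerivAt_slice_snd (hf.differentiable one_ne_zero) x) (hc.comp hx)
    (fun y hy => h0 _ (hx.frontier_preimage_subset _ hy)) (x₀ := z₀ x) fun y hy => hL _ hy

/-- The Jacobian determinant of a pair vanishing on the boundary has mean zero. -/
theorem setIntegral_jacobian_eq_zero (hΩ : IsOpen Ω) (hb : Bornology.IsBounded Ω)
    {v w : ℝ × ℝ → ℝ} (hv : ContDiff ℝ 1 v) (hw : ContDiff ℝ 2 w)
    (h0 : ∀ p ∈ frontier Ω, v p = 0) :
    ∫ p in Ω, (dZ v p * dTh w p - dTh v p * dZ w p) = 0 := by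
  have hw1 := contDiff_dTh (m := 1) hw (by norm_num)
  have hw2 := contDiff_dZ (m := 1) hw (by norm_num)
  have e1 := setIntegral_dZ_eq_zero hΩ hb (hv.mul hw1) fun p hp => by simp [h0 p hp]
  have e2 := setIntegral_dTh_eq_zero hΩ hb (hv.mul hw2) fun p hp => by simp [h0 p hp]
  rw [← sub_zero (0 : ℝ)]
  nth_rewrite 1 [← e1]
  rw [← e2, ← integral_sub (integrableOn_of_isBounded hb (continuous_dZ (hv.mul hw1)))
    (integrableOn_of_isBounded hb (continuous_dTh (hv.mul hw2)))]
  congr 1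
  ext p
  have hvd := hv.differentiable one_ne_zero p
  have hsymm : dZ (dTh w) p = dTh (dZ w) p := by
    have hd : DifferentiableAt ℝ (fderiv ℝ w) p :=
      (hw.fderiv_right (m := 1) (by norm_num)).differentiable one_ne_zero p
    have hs := (hw.contDiffAt (x := p)).isSymmSndFDerivAt (by simp)
    have := hs.eq (0, 1) (1, 0)
    unfold dZ dTh
    rw [fderiv_clm_apply hd (differentiableAt_const _),
      fderiv_clm_apply hd (differentiableAt_const _)]
    simpa using this
  have m1 : dZ (v * dTh w) p = v p * dZ (dTh w) p + dTh w p * dZ v p := by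
    rw [dZ, fderiv_mul hvd (hw1.differentiable one_ne_zero p)]
    rfl
  have m2 : dTh (v * dZ w) p = v p * dTh (dZ w) p + dZ w p * dTh v p := by
    rw [dTh, fderiv_mul hvd (hw2.differentiable one_ne_zero p)]
    rfl
  have m1' : dZ (fun p => v p * dTh w p) p = dZ (v * dTh w) p := rfl
  have m2' : dTh (fun p => v p * dZ w p) p = dTh (v * dZ w) p := rfl
  rw [m1', m2', m1, m2, hsymm]
  ring

end Slices

/-- Pointwise coercivity of the symmetrized gradient after elimination of the normal component, up
to a null Lagrangian and lower order terms. Here `s = A_θ`, `t = A_z`, `b = A_{θ,z}`,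
`d = A_{z,θ}`, and `v₁, v₂, w₁, w₂` are the partial derivatives of `v = u_θ` and `w = u_z`. -/
theorem korn_pointwise {a A B ρ0 ρ1 s t b d ρ k u v w v₁ v₂ w₁ w₂ : ℝ} (ha : 0 < a) (hA : 0 < A)
    (hρ0 : 0 < ρ0) (hs : a ≤ s) (ht : a ≤ t) (htA : t ≤ A) (hb : |b| ≤ B)
    (hd : |d| ≤ B) (hρ : ρ0 ≤ ρ) (hρ' : ρ ≤ ρ1) :
    a / (A * (1 + ρ1)) * (v₂ ^ 2 + w₂ ^ 2) + 2 * (v₂ * w₁ - v₁ * w₂) ≤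
      (4 * ρ1 + 4 / ρ0 + 4) * (s * t *
        (((t * v₁ + t * s * k * u + b * w) / (t * s)) ^ 2 +
        2 * (((s * v₂ - d * w) / (t * s) + (t * w₁ - b * v) / (t * s)) / 2) ^ 2 +
        ((s * w₂ + t * s * (ρ * k) * u + d * v) / (t * s)) ^ 2)) +
      (4 * ρ1 + 4 / ρ0 + 4) * (B ^ 2 / a ^ 2) * (v ^ 2 + w ^ 2) := by
  have hs0 : 0 < s := ha.trans_le hs
  have ht0 : 0 < t := ha.trans_le ht
  have hρp : 0 < ρ := hρ0.trans_le hρ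
  have hst : 0 < s * t := mul_pos hs0 ht0
  set F := (t * v₁ + t * s * k * u + b * w) / (t * s) with hF
  set G := ((s * v₂ - d * w) / (t * s) + (t * w₁ - b * v) / (t * s)) / 2 with hG
  set H := (s * w₂ + t * s * (ρ * k) * u + d * v) / (t * s) with hH
  set K := 4 * ρ1 + 4 / ρ0 + 4 with hK
  set p := b / (s * t) with hp
  set q := d / (s * t) with hq
  have hX : ρ * (v₁ / s) - w₂ / t = ρ * F - H - ρ * p * w + q * v := by
    rw [hF, hH, hp, hq]; field_simp; ring
  have hY : v₂ / t + w₁ / s = 2 * G + q * w + p * v := by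
    rw [hG, hp, hq]; field_simp; ring
  have hinv : 1 / ρ ≤ 1 / ρ0 := one_div_le_one_div_of_le hρ0 hρ
  have hinv0 : 0 < 1 / ρ := by positivity
  have e4 : 4 / ρ0 = 4 * (1 / ρ0) := by ring
  have hρr : ρ * (1 / ρ) = 1 := mul_one_div_cancel hρp.ne'
  have hK1 : 4 * ρ + 4 ≤ K := by
    have : 0 ≤ 4 / ρ0 := by positivity
    linarith
  have hK2 : 4 * (1 / ρ) + 4 ≤ K := by linarith
  set r := 1 / ρ with hr
  set M := B ^ 2 / a ^ 2 / (s * t) with hM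
  have hsq : ∀ x, |x| ≤ B → (x / (s * t)) ^ 2 ≤ M := fun x hx => by
    have h1 : x ^ 2 ≤ B ^ 2 := sq_le_sq' (abs_le.1 hx).1 (abs_le.1 hx).2
    have h2 : a ^ 2 ≤ s * t := by rw [sq]; exact mul_le_mul hs ht ha.le hs0.le
    rw [div_pow, sq (s * t), ← div_div]
    exact div_le_div_of_nonneg_right (div_le_div₀ (sq_nonneg B) h1 (by positivity) h2) hst.le
  have hpM : p ^ 2 ≤ M := hsq b hb
  have hqM : q ^ 2 ≤ M := hsq d hd
  have hM0 : 0 ≤ M := (sq_nonneg p).trans hpM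
  clear_value F G H K p q r M
  have hX2 : (ρ * F - H - ρ * p * w + q * v) ^ 2 * r ≤
      4 * ρ * F ^ 2 + 4 * r * H ^ 2 + 4 * ρ * (p ^ 2 * w ^ 2) + 4 * r * (q ^ 2 * v ^ 2) := by
    have h4 : (ρ * F - H - ρ * p * w + q * v) ^ 2 ≤
        4 * ((ρ * F) ^ 2 + H ^ 2 + (ρ * p * w) ^ 2 + (q * v) ^ 2) := by
      linarith [sq_nonneg (ρ * F + H), sq_nonneg (ρ * F + ρ * p * w), sq_nonneg (ρ * F - q * v),
        sq_nonneg (H - ρ * p * w), sq_nonneg (H + q * v), sq_nonneg (ρ * p * w + q * v)]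
    refine (mul_le_mul_of_nonneg_right h4 hinv0.le).trans_eq ?_
    linear_combination (4 * ρ * F ^ 2 + 4 * ρ * (p ^ 2 * w ^ 2)) * hρr
  have hY2 : (2 * G + q * w + p * v) ^ 2 ≤
      8 * G ^ 2 + 4 * (q ^ 2 * w ^ 2) + 4 * (p ^ 2 * v ^ 2) := by
    linarith [sq_nonneg (2 * G - q * w - p * v), sq_nonneg (q * w - p * v)]
  have hpw := mul_le_mul_of_nonneg_right hpM (sq_nonneg w)
  have hpv := mul_le_mul_of_nonneg_right hpM (sq_nonneg v)
  have hqw := mul_le_mul_of_nonneg_right hqM (sq_nonneg w)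
  have hqv := mul_le_mul_of_nonneg_right hqM (sq_nonneg v)
  have hsum : (ρ * (v₁ / s) - w₂ / t) ^ 2 * r + (v₂ / t + w₁ / s) ^ 2 ≤
      K * (F ^ 2 + 2 * G ^ 2 + H ^ 2) + K * M * (v ^ 2 + w ^ 2) := by
    rw [hX, hY]
    have l1 := mul_le_mul_of_nonneg_left hpw hρp.le
    have l2 := mul_le_mul_of_nonneg_left hqv hinv0.le
    have l3 := mul_le_mul_of_nonneg_right hK1 (mul_nonneg hM0 (sq_nonneg w))
    have l4 := mul_le_mul_of_nonneg_right hK2 (mul_nonneg hM0 (sq_nonneg v))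
    have l5 := mul_le_mul_of_nonneg_right (show 4 * ρ ≤ K by linarith) (sq_nonneg F)
    have l6 := mul_le_mul_of_nonneg_right (show 4 * r ≤ K by linarith) (sq_nonneg H)
    have l7 := mul_le_mul_of_nonneg_right (show 4 ≤ K by linarith) (sq_nonneg G)
    linarith
  have hlow : a / (A * (1 + ρ1)) * (v₂ ^ 2 + w₂ ^ 2) + 2 * (v₂ * w₁ - v₁ * w₂) ≤
      s * t * ((ρ * (v₁ / s) - w₂ / t) ^ 2 * r + (v₂ / t + w₁ / s) ^ 2) := by
    have hexp : s * t * ((ρ * (v₁ / s) - w₂ / t) ^ 2 * r + (v₂ / t + w₁ / s) ^ 2) =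
        ρ * (t / s) * v₁ ^ 2 + s / (t * ρ) * w₂ ^ 2 + s / t * v₂ ^ 2 + t / s * w₁ ^ 2
          + 2 * (v₂ * w₁ - v₁ * w₂) := by
      rw [hr]; field_simp; ring
    have c1 : a / (A * (1 + ρ1)) ≤ s / (t * ρ) :=
      div_le_div₀ hs0.le hs (by positivity)
        (mul_le_mul htA (by linarith) hρp.le hA.le)
    have c2 : a / (A * (1 + ρ1)) ≤ s / t :=
      div_le_div₀ hs0.le hs ht0 (htA.trans (le_mul_of_one_le_right hA.le (by linarith)))
    have d1 := mul_le_mul_of_nonneg_right c1 (sq_nonneg w₂)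
    have d2 := mul_le_mul_of_nonneg_right c2 (sq_nonneg v₂)
    have d3 : 0 ≤ ρ * (t / s) * v₁ ^ 2 := by positivity
    have d4 : 0 ≤ t / s * w₁ ^ 2 := by positivity
    rw [hexp]
    linarith
  refine hlow.trans ((mul_le_mul_of_nonneg_left hsum hst.le).trans_eq ?_)
  have hMst : s * t * M = B ^ 2 / a ^ 2 := by rw [hM]; field_simp
  linear_combination K * (v ^ 2 + w ^ 2) * hMst

theorem abs_dTh_le (f : ℝ × ℝ → ℝ) (p : ℝ × ℝ) : |dTh f p| ≤ ‖fderiv ℝ f p‖ := by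
  simpa [dTh] using (fderiv ℝ f p).le_opNorm (1, 0)

theorem abs_dZ_le (f : ℝ × ℝ → ℝ) (p : ℝ × ℝ) : |dZ f p| ≤ ‖fderiv ℝ f p‖ := by
  simpa [dZ] using (fderiv ℝ f p).le_opNorm (0, 1)

namespace Setup2D

variable {S : Setup2D}

theorem Base.isBounded_E (hS : S.Base) : Bornology.IsBounded S.E :=
  ((Metric.isBounded_Icc (0 : ℝ) 1).prod (Metric.isBounded_Icc (0 : ℝ) 1)).subset fun p hp => by
    obtain ⟨h0, -, h1⟩ := hS.1 p.1 (Ioo_subset_Icc_self hp.1)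
    exact ⟨Ioo_subset_Icc_self hp.1, h0.trans hp.2.1.le, hp.2.2.le.trans h1⟩

theorem Base.continuousOn_FsymSq (hS : S.Base) :
    ContinuousOn (fun p => S.Ath p * S.Az p * S.FsymSq p) (closure S.E) := by
  obtain ⟨-, hAth, hAz, hkth, hkz, hpos, hut, huth, huz⟩ := hS
  have hne : ∀ p ∈ closure S.E, S.Az p * S.Ath p ≠ 0 := fun p hp =>
    (mul_pos (hpos p hp).2 (hpos p hp).1).ne'
  have := hAth.continuous
  have := hAz.continuous
  have := hkth.continuous
  have := hkz.continuous
  have := hut.continuous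
  have := huth.continuous
  have := huz.continuous
  have := continuous_dZ hAth
  have := continuous_dTh hAz
  have := continuous_dZ huth
  have := continuous_dTh huth
  have := continuous_dZ huz
  have := continuous_dTh huz
  unfold FsymSq F23sym F22 F23 F32 F33
  fun_prop (disch := exact hne)

/-- A continuous function vanishing on `∂E` has its `L²` norm concentrated on the interior. -/
theorem nsq_le_setIntegral_interior {a A B : ℝ} (ha : 0 < a) (hS : S.Base)
    (hbd : S.Bounds a A B) {f : ℝ × ℝ → ℝ} (hf : Continuous f)
    (h0 : ∀ p ∈ frontier S.E, f p = 0) :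
    S.nsq f ≤ A ^ 2 * ∫ p in interior S.E, f p ^ 2 := by
  have hAth : Continuous S.Ath := hS.2.1.continuous
  have hAz : Continuous S.Az := hS.2.2.1.continuous
  have hcb : Bornology.IsBounded (closure S.E) := hS.isBounded_E.closure
  have i1 : IntegrableOn (fun p => S.Ath p * S.Az p * f p * f p) (closure S.E) :=
    integrableOn_of_isBounded hcb (by fun_prop)
  have i2 : IntegrableOn (fun p => A ^ 2 * f p ^ 2) (closure S.E) :=
    integrableOn_of_isBounded hcb (by fun_prop)
  have hm : MeasurableSet (closure S.E) := isClosed_closure.measurableSet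
  have hpt : ∀ p ∈ closure S.E, 0 ≤ S.Ath p * S.Az p * f p * f p ∧
      S.Ath p * S.Az p * f p * f p ≤ A ^ 2 * f p ^ 2 := fun p hp => by
    obtain ⟨h1, h2, h3, h4, -⟩ := hbd p hp
    have h5 : 0 ≤ S.Ath p * S.Az p := mul_nonneg (ha.le.trans h1) (ha.le.trans h3)
    have h6 : S.Ath p * S.Az p ≤ A ^ 2 := by nlinarith
    rw [mul_assoc (S.Ath p * S.Az p), ← sq]
    exact ⟨mul_nonneg h5 (sq_nonneg _), mul_le_mul_of_nonneg_right h6 (sq_nonneg _)⟩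
  calc S.nsq f ≤ ∫ p in closure S.E, S.Ath p * S.Az p * f p * f p :=
        setIntegral_mono_set i1 (ae_restrict_of_forall_mem hm fun p hp => (hpt p hp).1)
          subset_closure.eventuallyLE
    _ ≤ ∫ p in closure S.E, A ^ 2 * f p ^ 2 :=
        setIntegral_mono_on i1 i2 hm fun p hp => (hpt p hp).2
    _ = ∫ p in interior S.E, A ^ 2 * f p ^ 2 :=
        setIntegral_eq_of_subset_of_forall_sdiff_eq_zero hm interior_subset_closure
          fun p hp => by simp [h0 p hp]
    _ = A ^ 2 * ∫ p in interior S.E, f p ^ 2 := integral_const_mul _ _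

theorem setIntegral_interior_le_nF (hS : S.Base) :
    ∫ p in interior S.E, S.Ath p * S.Az p * S.FsymSq p ≤ S.nF := by
  have hi := hS.continuousOn_FsymSq.integrableOn_compact (μ := volume)
    hS.isBounded_E.isCompact_closure
  refine setIntegral_mono_set (hi.mono_set subset_closure) ?_ interior_subset.eventuallyLE
  refine ae_restrict_of_ae_restrict_of_subset subset_closure
    (ae_restrict_of_forall_mem isClosed_closure.measurableSet fun p hp => ?_)
  obtain ⟨h1, h2⟩ := hS.2.2.2.2.2.1 p hp
  have : 0 ≤ S.FsymSq p := by unfold FsymSq; positivity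
  exact mul_nonneg (mul_pos h1 h2).le this

/-- Energy estimate: the `z`-derivatives of the tangential components are controlled by the
symmetrized gradient and the tangential components themselves. -/
theorem energy_estimate {a A B ρ0 ρ1 c2 : ℝ} (ha : 0 < a) (hA : 0 < A) (hρ0 : 0 < ρ0)
    (hρ1 : 0 < ρ1) {ρ : ℝ × ℝ → ℝ} (hS : S.Base) (hC : S.Csq) (hZ : S.BZero)
    (hbd : S.Bounds a A B) (hρ : S.RhoHyp ρ ρ0 ρ1 c2) :
    a / (A * (1 + ρ1)) *
      ((∫ p in interior S.E, dZ S.uth p ^ 2) + ∫ p in interior S.E, dZ S.uz p ^ 2) ≤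
    (4 * ρ1 + 4 / ρ0 + 4) * S.nF + (4 * ρ1 + 4 / ρ0 + 4) * (B ^ 2 / a ^ 2) *
      ((∫ p in interior S.E, S.uth p ^ 2) + ∫ p in interior S.E, S.uz p ^ 2) := by
  have hb : Bornology.IsBounded (interior S.E) := hS.isBounded_E.subset interior_subset
  have hfr : ∀ p ∈ frontier (interior S.E), S.uth p = 0 := fun p hp =>
    (hZ p (frontier_interior_subset hp)).2.1
  have hv1 : ContDiff ℝ 1 S.uth := hC.2.2.2.1.of_le (by norm_num)
  have hw1 : ContDiff ℝ 1 S.uz := hC.2.2.2.2.of_le (by norm_num)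
  have cv := hv1.continuous
  have cw := hw1.continuous
  have cv1 := continuous_dTh hv1
  have cv2 := continuous_dZ hv1
  have cw1 := continuous_dTh hw1
  have cw2 := continuous_dZ hw1
  have hjac := setIntegral_jacobian_eq_zero isOpen_interior hb hv1 hC.2.2.2.2 hfr
  have iF : IntegrableOn (fun p => S.Ath p * S.Az p * S.FsymSq p) (interior S.E) :=
    (hS.continuousOn_FsymSq.integrableOn_compact hS.isBounded_E.isCompact_closure).mono_set
      interior_subset_closure
  have hnF := setIntegral_interior_le_nF hS
  have i {f : ℝ × ℝ → ℝ} (hf : Continuous f) : IntegrableOn f (interior S.E) :=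
    integrableOn_of_isBounded hb hf
  set m := a / (A * (1 + ρ1))
  set K := 4 * ρ1 + 4 / ρ0 + 4
  have hK : 0 ≤ K := by positivity
  have hmono : ∫ p in interior S.E, (m * (dZ S.uth p ^ 2 + dZ S.uz p ^ 2) +
        2 * (dZ S.uth p * dTh S.uz p - dTh S.uth p * dZ S.uz p)) ≤
      ∫ p in interior S.E, (K * (S.Ath p * S.Az p * S.FsymSq p) +
        K * (B ^ 2 / a ^ 2) * (S.uth p ^ 2 + S.uz p ^ 2)) := by
    refine setIntegral_mono_on (i (by fun_prop)) ((iF.const_mul K).add (i (by fun_prop)))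
      isOpen_interior.measurableSet fun p hp => ?_
    have hpc : p ∈ closure S.E := interior_subset_closure hp
    obtain ⟨h1, -, h3, h4, h5⟩ := hbd p hpc
    obtain ⟨h6, h7, -⟩ := hρ.2.2 p hpc
    have h8 : |dZ S.Ath p| ≤ B := by
      linarith [abs_dZ_le S.Ath p, norm_nonneg (fderiv ℝ S.Az p)]
    have h9 : |dTh S.Az p| ≤ B := by
      linarith [abs_dTh_le S.Az p, norm_nonneg (fderiv ℝ S.Ath p)]
    unfold FsymSq F23sym F22 F23 F32 F33
    rw [hρ.2.1 p (interior_subset hp)]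
    exact korn_pointwise ha hA hρ0 h1 h3 h4 h8 h9 h6 h7
  rw [integral_add (i (by fun_prop)) (i (by fun_prop)),
    integral_add (iF.const_mul K) (i (by fun_prop)), integral_const_mul, integral_const_mul,
    integral_const_mul, integral_const_mul, hjac,
    integral_add (i (by fun_prop)) (i (by fun_prop)),
    integral_add (i (by fun_prop)) (i (by fun_prop))] at hmono
  linarith [mul_le_mul_of_nonneg_left hnF hK]

end Setup2D

theorem korn_poincare_2d (a A B c ρ0 ρ1 c2 : ℝ)
    (ha : 0 < a) (hA : 0 < A) (hB : 0 < B) (hc : 0 < c)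
    (hρ0 : 0 < ρ0) (hρ1 : 0 < ρ1) (hc2 : 0 < c2) :
    ∃ C0 C : ℝ, 0 < C0 ∧ 0 < C ∧
      ∀ (S : Setup2D) (ρ : ℝ × ℝ → ℝ),
        S.Base → S.Csq → S.BZero → S.Bounds a A B → S.CodazziGauss →
        S.Comparable c → S.RhoHyp ρ ρ0 ρ1 c2 →
        (∀ θ ∈ Ioo (0 : ℝ) 1, S.z2 θ - S.z1 θ ≤ C0) →
        Real.sqrt (S.nsq S.uth) + Real.sqrt (S.nsq S.uz) ≤ C * Real.sqrt S.nF := by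
  set m := a / (A * (1 + ρ1)) with hm
  set K := (4 * ρ1 + 4 / ρ0 + 4) with hK
  have hm0 : 0 < m := by positivity
  have hK0 : 0 < K := by positivity
  set K' := K * (B ^ 2 / a ^ 2) with hK'
  have hK'0 : 0 < K' := by positivity
  set C0 := √(m / (8 * K')) with hC0
  have hC0sq : C0 ^ 2 = m / (8 * K') := Real.sq_sqrt (by positivity)
  refine ⟨C0, 2 * √(A ^ 2 * (K / K')), by positivity, by positivity, ?_⟩
  intro S ρ hS hC hZ hbd _ _ hρ hL
  have hv1 : ContDiff ℝ 1 S.uth := hC.2.2.2.1.of_le (by norm_num)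
  have hw1 : ContDiff ℝ 1 S.uz := hC.2.2.2.2.of_le (by norm_num)
  have hb : Bornology.IsBounded (interior S.E) := hS.isBounded_E.subset interior_subset
  have hthin : ∀ p ∈ interior S.E, |p.2 - S.z1 p.1| ≤ C0 := fun p hp => by
    have hpE := interior_subset hp
    rw [abs_of_pos (sub_pos.2 hpE.2.1)]
    linarith [hL p.1 hpE.1, hpE.2.2]
  have pv := setIntegral_sq_le_dZ isOpen_interior hb hv1
    (fun p hp => (hZ p (frontier_interior_subset hp)).2.1) hthin
  have pw := setIntegral_sq_le_dZ isOpen_interior hb hw1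
    (fun p hp => (hZ p (frontier_interior_subset hp)).2.2) hthin
  have nv := S.nsq_le_setIntegral_interior ha hS hbd hv1.continuous fun p hp => (hZ p hp).2.1
  have nw := S.nsq_le_setIntegral_interior ha hS hbd hw1.continuous fun p hp => (hZ p hp).2.2
  have hE := S.energy_estimate ha hA hρ0 hρ1 hS hC hZ hbd hρ
  rw [← hm, ← hK, ← hK'] at hE
  rw [hC0sq] at pv pw
  set I₁ := ∫ p in interior S.E, S.uth p ^ 2
  set I₂ := ∫ p in interior S.E, S.uz p ^ 2
  set J₁ := ∫ p in interior S.E, dZ S.uth p ^ 2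
  set J₂ := ∫ p in interior S.E, dZ S.uz p ^ 2
  have hI : 2 * K' * (I₁ + I₂) ≤ m * (J₁ + J₂) := by
    have e : m * (J₁ + J₂) =
        2 * K' * (4 * (m / (8 * K')) * J₁ + 4 * (m / (8 * K')) * J₂) := by
      field_simp; ring
    rw [e]
    exact mul_le_mul_of_nonneg_left (add_le_add pv pw) (by positivity)
  have hIF : I₁ + I₂ ≤ K / K' * S.nF := by
    rw [div_mul_eq_mul_div, le_div_iff₀ hK'0]
    linarith
  have hI₁ : 0 ≤ I₁ := integral_nonneg fun p => sq_nonneg _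
  have hI₂ : 0 ≤ I₂ := integral_nonneg fun p => sq_nonneg _
  have hbound : ∀ x, x ≤ A ^ 2 * (I₁ + I₂) → √x ≤ √(A ^ 2 * (K / K')) * √S.nF := fun x hx => by
    rw [← Real.sqrt_mul (by positivity)]
    refine Real.sqrt_le_sqrt (hx.trans ?_)
    rw [mul_assoc]
    exact mul_le_mul_of_nonneg_left hIF (sq_nonneg A)
  have b1 := hbound _ (nv.trans (mul_le_mul_of_nonneg_left (by linarith) (sq_nonneg A)))
  have b2 := hbound _ (nw.trans (mul_le_mul_of_nonneg_left (by linarith) (sq_nonneg A)))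
  linarith
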